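/- Fix an integer base β ≥ 2, precision t, and unit round-off u := β^{1−t}/2, and let 0 < C < 1. If t ≥ 1 + log_β[ ((1+C)(4+5C)/C) · Σ_{m=1}^{n−1} Σ_{ℓ=1}^{n−m} g[CP_ℓ(ℝ)]·g[CP_m(ℝ)] ], then for every real n×n matrix A admitting a completely pivoted floating-point elimination trajectory with unit round-off u, the floating-point growth factor satisfies G(A) ≤ (1+C)·g[CP_n(ℝ)]. -/

import Mathlib

open scoped BigOperators

/-- `geIter A k` is the Gaussian elimination iterate `A^{(k+1)}` (0-indexed, `geIter A 0 = A`).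
Entries with row or column index `< k` are left unchanged; they are irrelevant. -/
noncomputable def geIter {𝕜 : Type*} [Field 𝕜] {n : ℕ} (A : Matrix (Fin n) (Fin n) 𝕜) :
    ℕ → Matrix (Fin n) (Fin n) 𝕜
  | 0 => A
  | k + 1 => fun i j =>
    if h : k < n ∧ k + 1 ≤ i.1 ∧ k + 1 ≤ j.1 then
      geIter A k i j -
        geIter A k i ⟨k, h.1⟩ * geIter A k ⟨k, h.1⟩ j / geIter A k ⟨k, h.1⟩ ⟨k, h.1⟩
    else geIter A k i j

/-- The norm of the pivot `a^{(k+1)}_{k,k}` (0-indexed). -/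
noncomputable def pivotNorm {𝕜 : Type*} [RCLike 𝕜] {n : ℕ}
    (A : Matrix (Fin n) (Fin n) 𝕜) (k : ℕ) : ℝ :=
  if h : k < n then ‖geIter A k ⟨k, h⟩ ⟨k, h⟩‖ else 0

/-- The growth factor `g(A)`. -/
noncomputable def growth {𝕜 : Type*} [RCLike 𝕜] {n : ℕ} (A : Matrix (Fin n) (Fin n) 𝕜) : ℝ :=
  (⨆ k : Fin n, ⨆ i : Fin n, ⨆ j : Fin n,
      if k.1 ≤ i.1 ∧ k.1 ≤ j.1 then ‖geIter A k.1 i j‖ else 0) /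
    ⨆ i : Fin n, ⨆ j : Fin n, ‖A i j‖

/-- `A` is completely pivoted: `A ∈ CP_n(𝕜)`. -/
def IsCP {𝕜 : Type*} [RCLike 𝕜] {n : ℕ} (A : Matrix (Fin n) (Fin n) 𝕜) : Prop :=
  A.det ≠ 0 ∧ (∀ k : ℕ, k + 1 < n → pivotNorm A k ≠ 0) ∧
    ∀ (k : ℕ) (i j : Fin n), k ≤ i.1 → k ≤ j.1 → ‖geIter A k i j‖ ≤ pivotNorm A k

/-- `g[CP_n(𝕜)]`. -/
noncomputable def gCP (𝕜 : Type*) [RCLike 𝕜] (n : ℕ) : ℝ :=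
  sSup (growth '' {A : Matrix (Fin n) (Fin n) 𝕜 | IsCP A})

/-- A completely pivoted floating-point elimination trajectory for `A`, with unit round-off `u`.
`hatA k` is the floating-point iterate `Â^{(k+1)}` (0-indexed). -/
structure CPFloatTraj (n : ℕ) (u : ℝ) (A : Matrix (Fin n) (Fin n) ℝ) where
  hatA : ℕ → Matrix (Fin n) (Fin n) ℝ
  s : Fin n → ℕ → ℝ
  φ0 : Matrix (Fin n) (Fin n) ℝ
  φ : ℕ → Matrix (Fin n) (Fin n) ℝ
  θ : ℕ → Matrix (Fin n) (Fin n) ℝ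
  ψ : Fin n → ℕ → ℝ
  hφ0 : ∀ i j, |φ0 i j| ≤ u
  hφ : ∀ k i j, |φ k i j| ≤ u
  hθ : ∀ k i j, |θ k i j| ≤ u
  hψ : ∀ i k, |ψ i k| ≤ u
  init : ∀ i j, hatA 0 i j = A i j * (1 + φ0 i j)
  hs : ∀ (k : ℕ) (hk : k < n) (i : Fin n), k ≤ i.1 →
    s i k = hatA k i ⟨k, hk⟩ / hatA k ⟨k, hk⟩ ⟨k, hk⟩ * (1 + ψ i k)
  step : ∀ (k : ℕ) (hk : k < n) (i j : Fin n), k + 1 ≤ i.1 → k + 1 ≤ j.1 →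
    hatA (k + 1) i j = (hatA k i j - s i k * hatA k ⟨k, hk⟩ j * (1 + θ k i j)) * (1 + φ k i j)
  pivot_ne : ∀ (k : ℕ) (hk : k < n), hatA k ⟨k, hk⟩ ⟨k, hk⟩ ≠ 0
  piv : ∀ (k : ℕ) (hk : k < n) (i j : Fin n), k ≤ i.1 → k ≤ j.1 →
    |hatA k i j| ≤ |hatA k ⟨k, hk⟩ ⟨k, hk⟩|
  s_le : ∀ (k : ℕ) (i : Fin n), k < n → k ≤ i.1 → |s i k| ≤ 1
  sθ_le : ∀ (k : ℕ) (i j : Fin n), k < n → k ≤ i.1 → |s i k * (1 + θ k i j)| ≤ 1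

/-- The floating-point growth factor `G(A)` of a trajectory `hatA`. -/
noncomputable def floatGrowth {n : ℕ} (hatA : ℕ → Matrix (Fin n) (Fin n) ℝ) : ℝ :=
  (⨆ k : Fin n, ⨆ i : Fin n, ⨆ j : Fin n,
      if k.1 ≤ i.1 ∧ k.1 ≤ j.1 then |hatA k.1 i j| else 0) /
    ⨆ i : Fin n, ⨆ j : Fin n, |hatA 0 i j|

lemma entry_le_sup {N : ℕ} (f : Fin N → Fin N → ℝ) (i j : Fin N) :
    f i j ≤ ⨆ i : Fin N, ⨆ j : Fin N, f i j :=
  (le_ciSup (Set.finite_range (f i)).bddAbove j).trans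
    (le_ciSup (f := fun i => ⨆ j, f i j) (Set.finite_range _).bddAbove i)

lemma entry_le_sup3 {N : ℕ} (f : Fin N → Fin N → Fin N → ℝ) (k i j : Fin N) :
    f k i j ≤ ⨆ k : Fin N, ⨆ i : Fin N, ⨆ j : Fin N, f k i j :=
  (entry_le_sup (f k) i j).trans
    (le_ciSup (f := fun k => ⨆ i, ⨆ j, f k i j) (Set.finite_range _).bddAbove k)

lemma geIter_succ {N : ℕ} (A : Matrix (Fin N) (Fin N) ℝ) (k : ℕ) (hk : k < N) (i j : Fin N)
    (hi : k + 1 ≤ i.1) (hj : k + 1 ≤ j.1) :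
    geIter A (k + 1) i j = geIter A k i j -
      geIter A k i ⟨k, hk⟩ * geIter A k ⟨k, hk⟩ j / geIter A k ⟨k, hk⟩ ⟨k, hk⟩ :=
  dif_pos (c := k < N ∧ k + 1 ≤ i.1 ∧ k + 1 ≤ j.1) ⟨hk, hi, hj⟩

lemma pivotNorm_eq {N : ℕ} (A : Matrix (Fin N) (Fin N) ℝ) (k : ℕ) (hk : k < N) :
    pivotNorm A k = ‖geIter A k ⟨k, hk⟩ ⟨k, hk⟩‖ := dif_pos hk

lemma geIter_bound {N : ℕ} (A : Matrix (Fin N) (Fin N) ℝ) (h : IsCP A) (D : ℝ)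
    (hD : ∀ i j, ‖A i j‖ ≤ D) (k : ℕ) : ∀ i j : Fin N, k ≤ i.1 → k ≤ j.1 →
      ‖geIter A k i j‖ ≤ 2 ^ k * D := by
  induction k with
  | zero => intro i j _ _; simpa [geIter] using hD i j
  | succ k ih =>
    intro i j hi hj
    have hk : k < N := by omega
    rw [geIter_succ _ k hk i j hi hj]
    have h1 := ih i j (by omega) (by omega)
    have h2 := ih ⟨k, hk⟩ j le_rfl (by omega)
    have h3 := h.2.2 k i ⟨k, hk⟩ (by omega) le_rfl
    rw [pivotNorm_eq _ _ hk] at h3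
    have h4 : ‖geIter A k i ⟨k, hk⟩ * geIter A k ⟨k, hk⟩ j / geIter A k ⟨k, hk⟩ ⟨k, hk⟩‖
        ≤ ‖geIter A k ⟨k, hk⟩ j‖ := by
      rw [norm_div, norm_mul]
      refine div_le_of_le_mul₀ (norm_nonneg _) (norm_nonneg _) ?_
      rw [mul_comm]
      exact mul_le_mul_of_nonneg_left h3 (norm_nonneg _)
    refine (norm_sub_le _ _).trans ?_
    rw [pow_succ]
    linarith

lemma growth_bdd (N : ℕ) :
    BddAbove (growth '' {A : Matrix (Fin N) (Fin N) ℝ | IsCP A}) := by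
  refine ⟨2 ^ N, ?_⟩
  rintro _ ⟨A, hA, rfl⟩
  have hD := entry_le_sup (fun i j => ‖A i j‖)
  have hD0 : 0 ≤ ⨆ i : Fin N, ⨆ j : Fin N, ‖A i j‖ :=
    Real.iSup_nonneg fun i => Real.iSup_nonneg fun j => norm_nonneg _
  unfold growth
  refine div_le_of_le_mul₀ hD0 (by positivity) ?_
  refine Real.iSup_le (fun k => Real.iSup_le (fun i => Real.iSup_le (fun j => ?_) ?_) ?_) ?_
  · split_ifs with h
    · refine (geIter_bound A hA _ hD k i j h.1 h.2).trans ?_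
      exact mul_le_mul_of_nonneg_right (pow_le_pow_right₀ (by norm_num) k.2.le) hD0
    · positivity
  all_goals positivity

lemma gCP_nonneg (N : ℕ) : 0 ≤ gCP ℝ N := by
  refine Real.sSup_nonneg ?_
  rintro _ ⟨A, hA, rfl⟩
  unfold growth
  refine div_nonneg (Real.iSup_nonneg fun k => Real.iSup_nonneg fun i =>
    Real.iSup_nonneg fun j => ?_) (Real.iSup_nonneg fun i => Real.iSup_nonneg fun j => norm_nonneg _)
  split_ifs
  · exact norm_nonneg _
  · exact le_rfl

lemma pivot_le {N : ℕ} (A : Matrix (Fin N) (Fin N) ℝ) (h : IsCP A) (hN : 0 < N)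
    (h0 : A ⟨0, hN⟩ ⟨0, hN⟩ ≠ 0) (k : ℕ) (hk : k < N) :
    ‖geIter A k ⟨k, hk⟩ ⟨k, hk⟩‖ ≤ gCP ℝ N * ‖A ⟨0, hN⟩ ⟨0, hN⟩‖ := by
  have hD : (⨆ i : Fin N, ⨆ j : Fin N, ‖A i j‖) = ‖A ⟨0, hN⟩ ⟨0, hN⟩‖ := by
    refine le_antisymm ?_ (entry_le_sup (fun i j => ‖A i j‖) _ _)
    refine Real.iSup_le (fun i => Real.iSup_le (fun j => ?_) (norm_nonneg _)) (norm_nonneg _)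
    have := h.2.2 0 i j (Nat.zero_le _) (Nat.zero_le _)
    rw [pivotNorm_eq _ _ hN] at this
    simpa [geIter] using this
  have hpos : 0 < ‖A ⟨0, hN⟩ ⟨0, hN⟩‖ := norm_pos_iff.2 h0
  have hg : growth A ≤ gCP ℝ N := le_csSup (growth_bdd N) ⟨A, h, rfl⟩
  refine le_trans ?_ (mul_le_mul_of_nonneg_right hg hpos.le)
  unfold growth
  rw [hD, div_mul_cancel₀ _ hpos.ne']
  have := entry_le_sup3 (fun k i j : Fin N =>
    if k.1 ≤ i.1 ∧ k.1 ≤ j.1 then ‖geIter A k.1 i j‖ else 0) ⟨k, hk⟩ ⟨k, hk⟩ ⟨k, hk⟩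
  simpa using this

lemma gCP_one : 1 ≤ gCP ℝ 1 := by
  have h : IsCP (1 : Matrix (Fin 1) (Fin 1) ℝ) := by
    refine ⟨by simp, fun k hk => by omega, ?_⟩
    intro k i j hi hj
    have hk : k < 1 := by omega
    rw [pivotNorm_eq _ _ hk]
    obtain rfl : i = ⟨k, hk⟩ := Subsingleton.elim _ _
    obtain rfl : j = ⟨k, hk⟩ := Subsingleton.elim _ _
    exact le_rfl
  have := pivot_le 1 h Nat.one_pos (by simp) 0 Nat.one_pos
  simpa [geIter] using this

/-- Abstract elimination with absolute errors at most `e` times the pivot. -/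
structure Near (e : ℝ) (a : ℕ → ℕ → ℕ → ℝ) (N : ℕ) : Prop where
  ne : ∀ k < N, a k k k ≠ 0
  piv : ∀ k i j, k ≤ i → k ≤ j → i < N → j < N → |a k i j| ≤ |a k k k|
  err : ∀ k i j, k < i → k < j → i < N → j < N →
    |a (k + 1) i j - (a k i j - a k i k * a k k j / a k k k)| ≤ e * |a k k k|

/-- local error -/
noncomputable def lerr (a : ℕ → ℕ → ℕ → ℝ) (k i j : ℕ) : ℝ :=
  a (k + 1) i j - (a k i j - a k i k * a k k j / a k k k)

/-- relative pivot increase -/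
noncomputable def epsi (e : ℝ) (a : ℕ → ℕ → ℕ → ℝ) (N k : ℕ) : ℝ :=
  (e * ∑ l ∈ Finset.Ico k (N - 1), |a l l l|) / |a k k k|

/-- iterates of the nearby completely pivoted matrix -/
noncomputable def near (e : ℝ) (a : ℕ → ℕ → ℕ → ℝ) (N k i j : ℕ) : ℝ :=
  a k i j + ∑ l ∈ Finset.Ico k (min i j), lerr a l i j +
    if j ≤ i then epsi e a N j * a j i j else 0

lemma near_col (e : ℝ) (a : ℕ → ℕ → ℕ → ℝ) (N k i : ℕ) (h : k ≤ i) :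
    near e a N k i k = (1 + epsi e a N k) * a k i k := by
  simp [near, h]; ring

lemma near_row (e : ℝ) (a : ℕ → ℕ → ℕ → ℝ) (N k j : ℕ) (h : k < j) :
    near e a N k k j = a k k j := by
  simp [near, h.le, not_le.2 h]

lemma epsi_nonneg {e : ℝ} (he : 0 ≤ e) (a : ℕ → ℕ → ℕ → ℝ) (N k : ℕ) : 0 ≤ epsi e a N k := by
  unfold epsi
  exact div_nonneg (mul_nonneg he (Finset.sum_nonneg fun _ _ => abs_nonneg _)) (abs_nonneg _)

lemma near_step {e : ℝ} (he : 0 ≤ e) {a : ℕ → ℕ → ℕ → ℝ} {N : ℕ} (h : Near e a N)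
    (k i j : ℕ) (hi : k < i) (hj : k < j) (hiN : i < N) :
    near e a N (k + 1) i j =
      near e a N k i j - near e a N k i k * near e a N k k j / near e a N k k k := by
  rw [near_col _ _ _ _ _ hi.le, near_row _ _ _ _ _ hj, near_col _ _ _ _ _ le_rfl]
  have h0 := h.ne k (by omega)
  have h1 := epsi_nonneg he a N k
  have h2 : 1 + epsi e a N k ≠ 0 := by positivity
  rw [mul_assoc, mul_div_mul_left _ _ h2]
  unfold near
  rw [Finset.sum_eq_sum_Ico_succ_bot (show k < min i j by omega)]
  simp only [lerr]
  ring

lemma near_piv {e : ℝ} (he : 0 ≤ e) {a : ℕ → ℕ → ℕ → ℝ} {N : ℕ} (h : Near e a N)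
    (k i j : ℕ) (hi : k ≤ i) (hj : k ≤ j) (hiN : i < N) (hjN : j < N) :
    |near e a N k i j| ≤ |near e a N k k k| := by
  have hE : ∀ m < N, epsi e a N m * |a m m m| = e * ∑ l ∈ Finset.Ico m (N - 1), |a l l l| := by
    intro m hm
    unfold epsi
    exact div_mul_cancel₀ _ (abs_ne_zero.2 (h.ne m hm))
  have h1 : |near e a N k k k| = |a k k k| + e * ∑ l ∈ Finset.Ico k (N - 1), |a l l l| := by
    rw [near_col _ _ _ _ _ le_rfl, abs_mul,
      abs_of_nonneg (by have := epsi_nonneg he a N k; linarith), ← hE k (by omega)]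
    ring
  have h2 : |∑ l ∈ Finset.Ico k (min i j), lerr a l i j| ≤
      e * ∑ l ∈ Finset.Ico k (min i j), |a l l l| := by
    refine (Finset.abs_sum_le_sum_abs _ _).trans ?_
    rw [Finset.mul_sum]
    refine Finset.sum_le_sum fun l hl => ?_
    rw [Finset.mem_Ico] at hl
    exact h.err l i j (by omega) (by omega) hiN hjN
  have h3 : |if j ≤ i then epsi e a N j * a j i j else 0| ≤
      e * ∑ l ∈ Finset.Ico (min i j) (N - 1), |a l l l| := by
    split_ifs with hji
    · rw [min_eq_right hji, ← hE j hjN, abs_mul, abs_of_nonneg (epsi_nonneg he a N j)]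
      exact mul_le_mul_of_nonneg_left (h.piv j i j hji le_rfl hiN hjN) (epsi_nonneg he a N j)
    · rw [abs_zero]
      exact mul_nonneg he (Finset.sum_nonneg fun _ _ => abs_nonneg _)
  have h4 := h.piv k i j hi hj hiN hjN
  rw [h1, ← Finset.sum_Ico_consecutive _ (show k ≤ min i j by omega)
    (show min i j ≤ N - 1 by omega), mul_add]
  unfold near
  refine (abs_add_le _ _).trans ?_
  have := abs_add_le (a k i j) (∑ l ∈ Finset.Ico k (min i j), lerr a l i j)
  linarith

lemma near_ne {e : ℝ} (he : 0 ≤ e) {a : ℕ → ℕ → ℕ → ℝ} {N : ℕ} (h : Near e a N)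
    (k : ℕ) (hk : k < N) : near e a N k k k ≠ 0 := by
  rw [near_col _ _ _ _ _ le_rfl]
  have h1 := epsi_nonneg he a N k
  exact mul_ne_zero (by positivity) (h.ne k hk)

/-- the nearby completely pivoted matrix -/
noncomputable def nearM (e : ℝ) (a : ℕ → ℕ → ℕ → ℝ) (N : ℕ) : Matrix (Fin N) (Fin N) ℝ :=
  Matrix.of fun i j => near e a N 0 i j

lemma geIter_near {e : ℝ} (he : 0 ≤ e) {a : ℕ → ℕ → ℕ → ℝ} {N : ℕ} (h : Near e a N)
    (k : ℕ) : ∀ i j : Fin N, k ≤ i.1 → k ≤ j.1 →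
    geIter (nearM e a N) k i j = near e a N k i j := by
  induction k with
  | zero => intro i j _ _; rfl
  | succ k ih =>
    intro i j hi hj
    have hk : k < N := by omega
    rw [geIter_succ _ k hk i j hi hj, ih i j (by omega) (by omega), ih i ⟨k, hk⟩ (by omega) le_rfl,
      ih ⟨k, hk⟩ j le_rfl (by omega), ih ⟨k, hk⟩ ⟨k, hk⟩ le_rfl le_rfl]
    exact (near_step he h k i j hi hj i.2).symm

lemma near_tele {e : ℝ} (he : 0 ≤ e) {a : ℕ → ℕ → ℕ → ℝ} {N : ℕ} (h : Near e a N)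
    (i j : ℕ) (hi : i < N) (k : ℕ) (hk : k ≤ min i j) :
    near e a N 0 i j = near e a N k i j + ∑ l ∈ Finset.range k,
      near e a N l i l * (near e a N l l j / near e a N l l l) := by
  induction k with
  | zero => simp
  | succ k ih =>
    rw [ih (by omega), Finset.sum_range_succ, near_step he h k i j (by omega) (by omega) hi]
    ring

lemma near_det {e : ℝ} (he : 0 ≤ e) {a : ℕ → ℕ → ℕ → ℝ} {N : ℕ} (h : Near e a N) :
    Matrix.det (nearM e a N) ≠ 0 := by
  let L : Matrix (Fin N) (Fin N) ℝ := fun i k => if k ≤ i then near e a N k i k else 0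
  let U : Matrix (Fin N) (Fin N) ℝ := fun k j =>
    if k ≤ j then near e a N k k j / near e a N k k k else 0
  have hLU : nearM e a N = L * U := by
    ext i j
    change near e a N 0 i j = _
    rw [Matrix.mul_apply]
    have e1 : ∑ l : Fin N, L i l * U l j = ∑ l ∈ Finset.range N,
        if l ≤ min i.1 j.1 then near e a N l i l * (near e a N l l j / near e a N l l l) else 0 := by
      rw [← Fin.sum_univ_eq_sum_range (fun l => if l ≤ min i.1 j.1 then
        near e a N l i l * (near e a N l l j / near e a N l l l) else 0)]
      refine Finset.sum_congr rfl fun l _ => ?_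
      simp only [L, U, Fin.le_def, le_min_iff]
      by_cases h1 : l.1 ≤ i.1 <;> by_cases h2 : l.1 ≤ j.1 <;> simp [h1, h2]
    have e2 : Finset.filter (fun l => l ≤ min i.1 j.1) (Finset.range N) =
        Finset.range (min i.1 j.1 + 1) := by
      ext l
      simp only [Finset.mem_filter, Finset.mem_range]
      omega
    rw [e1, ← Finset.sum_filter, e2, Finset.sum_range_succ,
      near_tele he h i j i.2 (min i.1 j.1) le_rfl, add_comm]
    congr 1
    rcases le_total i.1 j.1 with hij | hij
    · rw [min_eq_left hij, mul_div_cancel₀ _ (near_ne he h i i.2)]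
    · rw [min_eq_right hij, div_self (near_ne he h j j.2), mul_one]
  rw [hLU, Matrix.det_mul]
  have hL : L.det = ∏ i, L i i := Matrix.det_of_isLowerTriangular L (by
    intro i j hij
    have : i < j := hij
    simp [L, this])
  have hU : U.det = ∏ i, U i i := Matrix.det_of_isUpperTriangular (by
    intro i j hij
    have : j < i := hij
    simp [U, this])
  rw [hL, hU]
  refine mul_ne_zero (Finset.prod_ne_zero_iff.2 fun i _ => ?_)
    (Finset.prod_ne_zero_iff.2 fun i _ => ?_)
  · simpa [L] using near_ne he h i i.2
  · simpa [U] using near_ne he h i i.2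

lemma near_isCP {e : ℝ} (he : 0 ≤ e) {a : ℕ → ℕ → ℕ → ℝ} {N : ℕ} (h : Near e a N) :
    IsCP (nearM e a N) := by
  have hp : ∀ k < N, pivotNorm (nearM e a N) k =
      |near e a N k k k| := by
    intro k hk
    rw [pivotNorm_eq _ _ hk, geIter_near he h k _ _ le_rfl le_rfl, Real.norm_eq_abs]
  refine ⟨near_det he h, ?_, ?_⟩
  · intro k hk
    rw [hp k (by omega)]
    exact abs_ne_zero.2 (near_ne he h k (by omega))
  · intro k i j hi hj
    rw [hp k (by omega), geIter_near he h k i j hi hj, Real.norm_eq_abs]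
    exact near_piv he h k i j hi hj i.2 j.2

lemma Near.mono {e : ℝ} {a : ℕ → ℕ → ℕ → ℝ} {N M : ℕ} (h : Near e a N) (hM : M ≤ N) :
    Near e a M :=
  ⟨fun k hk => h.ne k (by omega), fun k i j hi hj hi' hj' => h.piv k i j hi hj (by omega) (by omega),
    fun k i j hi hj hi' hj' => h.err k i j hi hj (by omega) (by omega)⟩

lemma near_pivot_le {e : ℝ} (he : 0 ≤ e) {a : ℕ → ℕ → ℕ → ℝ} {N : ℕ} (h : Near e a N)
    (k : ℕ) (hk : k < N) :
    |a k k k| ≤ gCP ℝ N * (|a 0 0 0| + e * ∑ l ∈ Finset.range (N - 1), |a l l l|) := by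
  have hN : 0 < N := by omega
  have := pivot_le (nearM e a N) (near_isCP he h) hN (near_ne he h 0 hN) k hk
  have h00 : nearM e a N ⟨0, hN⟩ ⟨0, hN⟩ = near e a N 0 0 0 := rfl
  rw [geIter_near he h k _ _ le_rfl le_rfl, h00, Real.norm_eq_abs, Real.norm_eq_abs,
    near_col _ _ _ _ _ le_rfl, near_col _ _ _ _ _ le_rfl, abs_mul, abs_mul,
    abs_of_nonneg (show 0 ≤ 1 + epsi e a N k by have := epsi_nonneg he a N k; linarith),
    abs_of_nonneg (show 0 ≤ 1 + epsi e a N 0 by have := epsi_nonneg he a N 0; linarith)] at this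
  have h0 : epsi e a N 0 * |a 0 0 0| = e * ∑ l ∈ Finset.range (N - 1), |a l l l| := by
    unfold epsi
    rw [div_mul_cancel₀ _ (abs_ne_zero.2 (h.ne 0 hN)), Nat.Ico_zero_eq_range]
  rw [← h0]
  have h1 := mul_nonneg (epsi_nonneg he a N k) (abs_nonneg (a k k k))
  calc |a k k k| ≤ (1 + epsi e a N k) * |a k k k| := by linarith
    _ ≤ _ := this
    _ = _ := by ring

lemma near_growth {e C : ℝ} (he : 0 ≤ e) (hC : 0 ≤ C) {a : ℕ → ℕ → ℕ → ℝ} (N : ℕ) :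
    Near e a N → e * (1 + C) * ∑ l ∈ Finset.range (N - 1), gCP ℝ (l + 1) ≤ C →
    ∀ k < N, |a k k k| ≤ (1 + C) * gCP ℝ N * |a 0 0 0| := by
  induction N using Nat.strong_induction_on with
  | _ N ih =>
    intro h hs k hk
    have h1 := near_pivot_le he h k hk
    have h2 : ∑ l ∈ Finset.range (N - 1), |a l l l| ≤
        ∑ l ∈ Finset.range (N - 1), (1 + C) * gCP ℝ (l + 1) * |a 0 0 0| := by
      refine Finset.sum_le_sum fun l hl => ?_
      rw [Finset.mem_range] at hl
      refine ih (l + 1) (by omega) (h.mono (by omega)) (le_trans ?_ hs) l (by omega)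
      refine mul_le_mul_of_nonneg_left ?_ (by positivity)
      refine Finset.sum_le_sum_of_subset_of_nonneg ?_ (fun _ _ _ => gCP_nonneg _)
      intro x hx
      simp only [Finset.mem_range] at *
      omega
    rw [← Finset.sum_mul, ← Finset.mul_sum] at h2
    have h3 := mul_le_mul_of_nonneg_left h2 he
    have h4 := mul_le_mul_of_nonneg_right hs (abs_nonneg (a 0 0 0))
    refine h1.trans ?_
    have : |a 0 0 0| + e * ∑ l ∈ Finset.range (N - 1), |a l l l| ≤ (1 + C) * |a 0 0 0| := by
      nlinarith
    calc _ ≤ gCP ℝ N * ((1 + C) * |a 0 0 0|) :=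
          mul_le_mul_of_nonneg_left this (gCP_nonneg N)
      _ = _ := by ring

lemma step_err {u x s r θ φ ψ c p y : ℝ} (hu : 0 ≤ u) (hp : p ≠ 0) (hs : s = c / p * (1 + ψ))
    (hy : y = (x - s * r * (1 + θ)) * (1 + φ)) (hφ : |φ| ≤ u) (hθ : |θ| ≤ u) (hψ : |ψ| ≤ u)
    (hx : |x| ≤ |p|) (hr : |r| ≤ |p|) (hc : |c| ≤ |p|) (hsθ : |s * (1 + θ)| ≤ 1) :
    |y - (x - c * r / p)| ≤ (4 * u + u ^ 2) * |p| := by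
  have hp' : 0 < |p| := abs_pos.2 hp
  have hq : |c / p| ≤ 1 := by
    rw [abs_div]; exact div_le_one_of_le₀ hc hp'.le
  have e1 : y - (x - c * r / p) =
      (x - s * (1 + θ) * r) * φ + (-(c / p * r)) * (ψ + θ + ψ * θ) := by
    rw [hy, hs]; ring
  have b1 : |x - s * (1 + θ) * r| ≤ 2 * |p| := by
    refine (abs_sub _ _).trans ?_
    rw [abs_mul]
    have := mul_le_mul hsθ hr (abs_nonneg _) zero_le_one
    linarith
  have b2 : |-(c / p * r)| ≤ |p| := by
    rw [abs_neg, abs_mul]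
    have := mul_le_mul hq hr (abs_nonneg _) zero_le_one
    linarith
  have b3 : |ψ + θ + ψ * θ| ≤ 2 * u + u ^ 2 := by
    refine (abs_add_le _ _).trans ?_
    have h1 := abs_add_le ψ θ
    have h2 := mul_le_mul hψ hθ (abs_nonneg _) hu
    rw [abs_mul]
    nlinarith
  rw [e1]
  refine (abs_add_le _ _).trans ?_
  rw [abs_mul, abs_mul]
  have c1 := mul_le_mul b1 hφ (abs_nonneg _) (by positivity)
  have c2 := mul_le_mul b2 b3 (abs_nonneg _) (by positivity)
  nlinarith

lemma traj_near {n : ℕ} {u : ℝ} (hu : 0 ≤ u) {A : Matrix (Fin n) (Fin n) ℝ}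
    (T : CPFloatTraj n u A) :
    Near (4 * u + u ^ 2) (fun k i j => if h : i < n ∧ j < n then
      T.hatA k ⟨i, h.1⟩ ⟨j, h.2⟩ else 0) n := by
  refine ⟨?_, ?_, ?_⟩
  · intro k hk
    simpa [hk] using T.pivot_ne k hk
  · intro k i j hi hj hiN hjN
    have hk : k < n := by omega
    simpa [hk, hiN, hjN] using T.piv k hk ⟨i, hiN⟩ ⟨j, hjN⟩ hi hj
  · intro k i j hi hj hiN hjN
    have hk : k < n := by omega
    simp only [hk, hiN, hjN, and_self, dite_true]
    exact step_err hu (T.pivot_ne k hk) (T.hs k hk ⟨i, hiN⟩ hi.le)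
      (T.step k hk ⟨i, hiN⟩ ⟨j, hjN⟩ hi hj) (T.hφ _ _ _) (T.hθ _ _ _) (T.hψ _ _)
      (T.piv k hk _ _ hi.le hj.le) (T.piv k hk _ _ le_rfl hj.le) (T.piv k hk _ _ hi.le le_rfl)
      (T.sθ_le k _ _ hk hi.le)

lemma prec_bound {n : ℕ} (β t : ℕ) (hβ : 2 ≤ β) (C : ℝ) (hC0 : 0 < C)
    (ht : (1 : ℝ) + Real.logb β ((1 + C) * (4 + 5 * C) / C *
        ∑ m ∈ Finset.Icc 1 (n - 1), ∑ ℓ ∈ Finset.Icc 1 (n - m),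
          gCP ℝ ℓ * gCP ℝ m) ≤ (t : ℝ)) (u : ℝ)
    (hu : u = (β : ℝ) ^ ((1 : ℤ) - (t : ℤ)) / 2) :
    (4 * u + u ^ 2) * (1 + C) * ∑ l ∈ Finset.range (n - 1), gCP ℝ (l + 1) ≤ C := by
  have hβ' : (2 : ℝ) ≤ β := by exact_mod_cast hβ
  have hu0 : 0 < u := by rw [hu]; positivity
  rcases Nat.lt_or_ge n 2 with hn | hn
  · have : n - 1 = 0 := by omega
    rw [this]; simpa using hC0.le
  set S := ∑ l ∈ Finset.range (n - 1), gCP ℝ (l + 1) with hS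
  set Q := ∑ m ∈ Finset.Icc 1 (n - 1), ∑ ℓ ∈ Finset.Icc 1 (n - m), gCP ℝ ℓ * gCP ℝ m with hQ
  have hS1 : 1 ≤ S := by
    refine gCP_one.trans ?_
    exact Finset.single_le_sum (f := fun l => gCP ℝ (l + 1)) (fun _ _ => gCP_nonneg _)
      (Finset.mem_range.2 (show 0 < n - 1 by omega))
  have hSQ : S ≤ Q := by
    have h1 : ∑ ℓ ∈ Finset.Icc 1 (n - 1), gCP ℝ ℓ * gCP ℝ 1 ≤ Q :=
      Finset.single_le_sum (f := fun m => ∑ ℓ ∈ Finset.Icc 1 (n - m), gCP ℝ ℓ * gCP ℝ m)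
        (fun _ _ => Finset.sum_nonneg fun _ _ => mul_nonneg (gCP_nonneg _) (gCP_nonneg _))
        (Finset.mem_Icc.2 ⟨le_rfl, by omega⟩)
    have h2 : S = ∑ ℓ ∈ Finset.Icc 1 (n - 1), gCP ℝ ℓ := by
      rw [hS, Finset.range_eq_Ico, Finset.sum_Ico_add' (fun l => gCP ℝ l) 0 (n - 1) 1]
      rfl
    rw [← Finset.sum_mul, ← h2] at h1
    nlinarith [gCP_one]
  set X := (1 + C) * (4 + 5 * C) / C * Q with hX
  have hQ0 : 0 < Q := by linarith
  have hX0 : 0 < X := by positivity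
  have h3 : X ≤ (β : ℝ) ^ ((t : ℝ) - 1) :=
    (Real.logb_le_iff_le_rpow (by linarith) hX0).1 (by linarith)
  have h4 : (β : ℝ) ^ ((t : ℝ) - 1) * (2 * u) = 1 := by
    have : 2 * u = (β : ℝ) ^ ((1 : ℝ) - t) := by
      rw [hu, mul_div_cancel₀ _ (by norm_num), ← Real.rpow_intCast]
      push_cast; rfl
    rw [this, ← Real.rpow_add (by linarith)]
    simp
  have h5 : X * (2 * u) ≤ 1 := by
    rw [← h4]; exact mul_le_mul_of_nonneg_right h3 (by positivity)
  have h6 : (1 + C) * (4 + 5 * C) * Q * (2 * u) ≤ C := by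
    have : (1 + C) * (4 + 5 * C) * Q * (2 * u) = C * (X * (2 * u)) := by
      rw [hX]; field_simp
    rw [this]; nlinarith
  have h7 : (1 + C) * (4 + 5 * C) * S * (2 * u) ≤ C :=
    le_trans (by gcongr) h6
  have h8 : u ≤ 1 := by
    by_contra hc
    push Not at hc
    have a1 : (1 + C) * (4 + 5 * C) * 1 * (2 * 1) ≤ (1 + C) * (4 + 5 * C) * S * (2 * u) := by
      gcongr
    nlinarith
  have h9 : (4 * u + u ^ 2) ≤ (4 + 5 * C) * (2 * u) := by nlinarith [mul_pos hC0 hu0]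
  calc (4 * u + u ^ 2) * (1 + C) * S ≤ (4 + 5 * C) * (2 * u) * (1 + C) * S := by gcongr
    _ = (1 + C) * (4 + 5 * C) * S * (2 * u) := by ring
    _ ≤ C := h7

/-- with enough precision, the floating-point growth factor under
complete pivoting is at most `(1+C)` times the exact one. -/
theorem float_cp_growth {n : ℕ} (β t : ℕ) (hβ : 2 ≤ β) (C : ℝ) (hC0 : 0 < C)
    (hC1 : C < 1)
    (ht : (1 : ℝ) + Real.logb β ((1 + C) * (4 + 5 * C) / C *
        ∑ m ∈ Finset.Icc 1 (n - 1), ∑ ℓ ∈ Finset.Icc 1 (n - m),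
          gCP ℝ ℓ * gCP ℝ m) ≤ (t : ℝ))
    (A : Matrix (Fin n) (Fin n) ℝ)
    (T : CPFloatTraj n ((β : ℝ) ^ ((1 : ℤ) - (t : ℤ)) / 2) A) :
    floatGrowth T.hatA ≤ (1 + C) * gCP ℝ n := by
  have hu : 0 ≤ (β : ℝ) ^ ((1 : ℤ) - (t : ℤ)) / 2 := by positivity
  have hb := prec_bound β t hβ C hC0 ht _ rfl
  have hg := near_growth (by positivity) hC0.le n (traj_near hu T) hb
  have hR : 0 ≤ (1 + C) * gCP ℝ n := mul_nonneg (by linarith) (gCP_nonneg n)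
  have hD0 : 0 ≤ ⨆ i : Fin n, ⨆ j : Fin n, |T.hatA 0 i j| :=
    Real.iSup_nonneg fun i => Real.iSup_nonneg fun j => abs_nonneg _
  have hRD := mul_nonneg hR hD0
  unfold floatGrowth
  refine div_le_of_le_mul₀ hD0 hR ?_
  refine Real.iSup_le (fun k => Real.iSup_le (fun i => Real.iSup_le (fun j => ?_) hRD) hRD) hRD
  split_ifs with h
  · have hn : 0 < n := k.pos
    have h1 := hg k k.2
    simp only [k.2, hn, and_self, dite_true] at h1
    refine (T.piv k k.2 i j h.1 h.2).trans (h1.trans ?_)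
    exact mul_le_mul_of_nonneg_left
      (entry_le_sup (fun i j => |T.hatA 0 i j|) ⟨0, hn⟩ ⟨0, hn⟩) hR
  · exact hRD
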